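/- arXiv:2302.01233 — 3 statements merged into one kernel-verified Lean document; each statement's English description precedes it below -/
import Mathlib

section
/- Let 𝔸 be a square matrix satisfying ‖𝔸^j‖_∞ ≤ ψ_N λ^j for all j ≥ 0, where λ ≤ C < 1 and 1 ≤ ψ_N < ∞, and let 1 ≤ m < ∞ be a constant. Then Σ_{k=1}^∞ k^m ‖𝔸^k‖_∞^m ≤ C ψ_N^m. Moreover, if Â satisfies ‖Â − 𝔸‖_∞ ≤ ξ_{N,T} ψ_N and ξ_{N,T} ψ_N² → 0, then for N, T sufficiently large Σ_{k=1}^∞ k^m ‖Â^k‖_∞^m ≤ C ψ_N^m and Σ_{k=1}^∞ k^m ‖Â^k − 𝔸^k‖_∞^m ≤ C ξ_{N,T}^m ψ_N^{3m}. -/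
open Filter

noncomputable section

/-- Induced max-row-sum (ℓ∞→ℓ∞ operator) norm of a matrix. -/
def matInf {α β : Type*} [Fintype β] (A : Matrix α β ℝ) : ℝ :=
  ⨆ i, ∑ j, |A i j|

attribute [local instance] Matrix.linftyOpNormedRing

theorem matInf_eq_norm {k : ℕ} (A : Matrix (Fin k) (Fin k) ℝ) : matInf A = ‖A‖ := by
  rw [Matrix.linfty_opNorm_def, Finset.sup_univ_eq_ciSup, NNReal.coe_iSup]
  simp [matInf]

section Perturbation

variable {R : Type*} [NormedRing R] {a b : R} {p d l r : ℝ}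

/-- Powers of a perturbed element grow at most at the rate `l + d * p`. -/
theorem norm_pow_mul_pow_le (hp : 0 ≤ p) (hd : 0 ≤ d) (hl : 0 ≤ l) (hr : l + d * p ≤ r)
    (ha : ∀ j : ℕ, ‖a ^ j‖ ≤ p * l ^ j) (hab : ‖b - a‖ ≤ d) (k : ℕ) :
    ∀ i : ℕ, ‖a ^ i * b ^ k‖ ≤ p * l ^ i * r ^ k := by
  have hr0 : 0 ≤ r := le_trans (by positivity) hr
  induction k with
  | zero => intro i; simpa using ha i
  | succ k ih =>
    intro i
    have hb : ‖b ^ k‖ ≤ p * r ^ k := by simpa using ih 0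
    have hsplit : a ^ i * b ^ (k + 1) = a ^ (i + 1) * b ^ k + a ^ i * (b - a) * b ^ k := by
      rw [pow_succ' b, pow_succ a]; noncomm_ring
    calc ‖a ^ i * b ^ (k + 1)‖
        ≤ ‖a ^ (i + 1) * b ^ k‖ + ‖a ^ i‖ * ‖b - a‖ * ‖b ^ k‖ := by
          rw [hsplit]
          refine (norm_add_le _ _).trans ?_
          gcongr
          exact norm_mul₃_le
      _ ≤ p * l ^ (i + 1) * r ^ k + (p * l ^ i) * d * (p * r ^ k) := by
          gcongr
          · exact ih (i + 1)
          · exact ha i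
      _ = p * l ^ i * r ^ k * (l + d * p) := by ring
      _ ≤ p * l ^ i * r ^ k * r := by gcongr
      _ = p * l ^ i * r ^ (k + 1) := by ring

/-- The difference of powers is linear in the size of the perturbation. -/
theorem norm_pow_mul_pow_sub_pow_le (hp : 0 ≤ p) (hd : 0 ≤ d) (hl : 0 ≤ l)
    (hr : l + d * p ≤ r) (ha : ∀ j : ℕ, ‖a ^ j‖ ≤ p * l ^ j) (hab : ‖b - a‖ ≤ d) (k : ℕ) :
    ∀ i : ℕ, ‖a ^ i * (b ^ (k + 1) - a ^ (k + 1))‖ ≤ p ^ 2 * d * l ^ i * ((k + 1) * r ^ k) := by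
  have hr0 : 0 ≤ r := le_trans (by positivity) hr
  have hlr : l ≤ r := le_trans (le_add_of_nonneg_right (by positivity)) hr
  have hb (k : ℕ) : ‖b ^ k‖ ≤ p * r ^ k := by
    simpa using norm_pow_mul_pow_le hp hd hl hr ha hab k 0
  have hmid (i k : ℕ) : ‖a ^ i * (b - a) * b ^ k‖ ≤ (p * l ^ i) * d * (p * r ^ k) := by
    refine norm_mul₃_le.trans ?_
    gcongr
    · exact ha i
    · exact hb k
  induction k with
  | zero =>
    intro i
    have := hmid i 0
    simp only [pow_zero, mul_one] at this
    simp only [zero_add, pow_one, Nat.cast_zero, pow_zero, mul_one]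
    linarith
  | succ k ih =>
    intro i
    have hsplit : a ^ i * (b ^ (k + 1 + 1) - a ^ (k + 1 + 1)) =
        a ^ (i + 1) * (b ^ (k + 1) - a ^ (k + 1)) + a ^ i * (b - a) * b ^ (k + 1) := by
      rw [pow_succ' b (k + 1), pow_succ' a (k + 1), pow_succ a i]; noncomm_ring
    calc ‖a ^ i * (b ^ (k + 1 + 1) - a ^ (k + 1 + 1))‖
        ≤ p ^ 2 * d * l ^ (i + 1) * ((k + 1) * r ^ k)
            + (p * l ^ i) * d * (p * r ^ (k + 1)) := by
          rw [hsplit]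
          exact (norm_add_le _ _).trans (add_le_add (ih (i + 1)) (hmid i (k + 1)))
      _ = p ^ 2 * d * l ^ i * ((k + 1) * r ^ k) * l + p ^ 2 * d * l ^ i * r ^ (k + 1) := by ring
      _ ≤ p ^ 2 * d * l ^ i * ((k + 1) * r ^ k) * r + p ^ 2 * d * l ^ i * r ^ (k + 1) := by
          gcongr
      _ = p ^ 2 * d * l ^ i * (((k + 1 : ℕ) + 1) * r ^ (k + 1)) := by push_cast; ring

end Perturbation

theorem Summable.rpow_of_one_le {f : ℕ → ℝ} {m : ℝ} (hf : Summable f) (h0 : ∀ k, 0 ≤ f k)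
    (hm : 1 ≤ m) : Summable fun k => f k ^ m := by
  refine Summable.of_norm_bounded_eventually_nat hf ?_
  filter_upwards [hf.tendsto_atTop_zero.eventually (ge_mem_nhds zero_lt_one)] with k hk
  rw [Real.norm_of_nonneg (Real.rpow_nonneg (h0 k) m)]
  simpa using Real.rpow_le_rpow_of_exponent_ge_of_imp (h0 k) hk hm (by intros; linarith)

theorem summable_natCast_mul_self_mul_pow_sub_one {r : ℝ} (hr0 : 0 ≤ r) (hr : r < 1) :
    Summable fun k : ℕ => (k : ℝ) * (k * r ^ (k - 1)) := by
  rw [← summable_nat_add_iff 1]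
  have h (j : ℕ) : Summable fun k : ℕ => (k : ℝ) ^ j * r ^ k :=
    summable_pow_mul_geometric_of_norm_lt_one j (by rwa [Real.norm_of_nonneg hr0])
  refine (((h 2).add ((h 1).mul_left 2)).add (h 0)).congr fun k => ?_
  simp only [Nat.add_sub_cancel]
  push_cast
  ring

theorem summable_and_tsum_rpow_mul_rpow_le {f g : ℕ → ℝ} {m c : ℝ} (hm : 1 ≤ m) (hc : 0 ≤ c)
    (hf : ∀ k, 0 ≤ f k) (hg : ∀ k, 0 ≤ g k) (hfg : ∀ k, f (k + 1) ≤ c * g (k + 1))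
    (hs : Summable fun k : ℕ => ((k : ℝ) * g k) ^ m) :
    Summable (fun k : ℕ => (k : ℝ) ^ m * f k ^ m) ∧
      ∑' k : ℕ, (k : ℝ) ^ m * f k ^ m ≤ (1 + ∑' k : ℕ, ((k : ℝ) * g k) ^ m) * c ^ m := by
  have hle (k : ℕ) : (k : ℝ) ^ m * f k ^ m ≤ ((k : ℝ) * g k) ^ m * c ^ m := by
    rcases k with _ | k
    · simp [Real.zero_rpow (by linarith : m ≠ 0)]
    · have := hg (k + 1)
      have := hf (k + 1)
      rw [← Real.mul_rpow (by positivity) (by positivity),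
        ← Real.mul_rpow (by positivity) (by positivity), mul_assoc, mul_comm (g _)]
      gcongr
      exact hfg k
  have hsum : Summable (fun k : ℕ => (k : ℝ) ^ m * f k ^ m) :=
    Summable.of_nonneg_of_le
      (fun k => mul_nonneg (by positivity) (Real.rpow_nonneg (hf k) m)) hle (hs.mul_right _)
  refine ⟨hsum, (hsum.tsum_le_tsum hle (hs.mul_right _)).trans ?_⟩
  rw [tsum_mul_right]
  gcongr
  linarith

/-- **Lemma A.6** (summability of powers of the companion matrix and of its
estimate): if `‖𝔸^j‖_∞ ≤ ψ_N λ^j` with `λ ≤ C < 1`, then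
`Σ_k k^m ‖𝔸^k‖_∞^m ≤ C ψ_N^m`; and if moreover `‖Â − 𝔸‖_∞ ≤ ξ_{N,T} ψ_N`
with `ξ_{N,T} ψ_N² → 0`, then for `N, T` sufficiently large
`Σ_k k^m ‖Â^k‖_∞^m ≤ C ψ_N^m` and `Σ_k k^m ‖Â^k − 𝔸^k‖_∞^m ≤ C ξ_{N,T}^m ψ_N^{3m}`. -/
theorem companion_power_summability (m lamC : ℝ) (hm : 1 ≤ m) (hlamC : lamC < 1) :
    ∃ C : ℝ, 0 < C ∧
      ∀ (n : ℕ → ℕ) (ψ ξ : ℕ → ℝ) (lam : ℝ),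
        0 ≤ lam → lam ≤ lamC →
        (∀ T, 1 ≤ ψ T) → (∀ T, 0 ≤ ξ T) →
      ∀ (A Ahat : (T : ℕ) → Matrix (Fin (n T)) (Fin (n T)) ℝ),
        (∀ T (j : ℕ), matInf (A T ^ j) ≤ ψ T * lam ^ j) →
        (∀ T, matInf (Ahat T - A T) ≤ ξ T * ψ T) →
        Tendsto (fun T => ξ T * ψ T ^ 2) atTop (nhds 0) →
        (∀ T, Summable (fun k : ℕ => (k : ℝ) ^ m * matInf (A T ^ k) ^ m) ∧
          (∑' k : ℕ, (k : ℝ) ^ m * matInf (A T ^ k) ^ m) ≤ C * ψ T ^ m) ∧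
        (∀ᶠ T in atTop,
          (Summable (fun k : ℕ => (k : ℝ) ^ m * matInf (Ahat T ^ k) ^ m) ∧
            (∑' k : ℕ, (k : ℝ) ^ m * matInf (Ahat T ^ k) ^ m) ≤ C * ψ T ^ m) ∧
          (Summable (fun k : ℕ => (k : ℝ) ^ m * matInf (Ahat T ^ k - A T ^ k) ^ m) ∧
            (∑' k : ℕ, (k : ℝ) ^ m * matInf (Ahat T ^ k - A T ^ k) ^ m)
              ≤ C * ξ T ^ m * ψ T ^ (3 * m))) := by
  set r : ℝ := (max lamC 0 + 1) / 2 with hr_def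
  have hmax : max lamC 0 < 1 := max_lt hlamC one_pos
  have hr0 : 0 ≤ r := by have := le_max_right lamC 0; positivity
  have hr1 : r < 1 := by linarith
  have hlr : lamC < r := by have := le_max_left lamC 0; linarith
  have hg0 (k : ℕ) : 0 ≤ (k : ℝ) * r ^ (k - 1) := by positivity
  have hs : Summable fun k : ℕ => ((k : ℝ) * (k * r ^ (k - 1))) ^ m :=
    (summable_natCast_mul_self_mul_pow_sub_one hr0 hr1).rpow_of_one_le
      (fun k => by positivity) hm
  have hpow (k : ℕ) : r ^ (k + 1) ≤ ((k + 1 : ℕ) : ℝ) * r ^ (k + 1 - 1) := by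
    rw [Nat.add_sub_cancel, pow_succ']
    gcongr
    push_cast
    have : (0 : ℝ) ≤ k := k.cast_nonneg
    linarith
  refine ⟨1 + ∑' k : ℕ, ((k : ℝ) * (k * r ^ (k - 1))) ^ m, ?_, ?_⟩
  · have : 0 ≤ ∑' k : ℕ, ((k : ℝ) * (k * r ^ (k - 1))) ^ m :=
      tsum_nonneg fun k => by positivity
    linarith
  intro n ψ ξ lam hlam0 hlam hψ hξ A Ahat hA hAhat hlim
  simp only [matInf_eq_norm] at hA hAhat ⊢
  have hψ0 (T : ℕ) : 0 ≤ ψ T := zero_le_one.trans (hψ T)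
  refine ⟨fun T => summable_and_tsum_rpow_mul_rpow_le hm (hψ0 T) (fun _ => norm_nonneg _) hg0
    (fun k => (hA T (k + 1)).trans ?_) hs, ?_⟩
  · refine mul_le_mul_of_nonneg_left ((pow_le_pow_left₀ hlam0 ?_ _).trans (hpow k)) (hψ0 T)
    linarith
  filter_upwards [hlim.eventually (ge_mem_nhds (sub_pos.2 hlr))] with T hT
  have hd : 0 ≤ ξ T * ψ T := mul_nonneg (hξ T) (hψ0 T)
  have hrate : lam + ξ T * ψ T * ψ T ≤ r := by
    rw [mul_assoc, ← sq]; linarith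
  constructor
  · refine summable_and_tsum_rpow_mul_rpow_le hm (hψ0 T) (fun _ => norm_nonneg _) hg0
      (fun k => ?_) hs
    have h := norm_pow_mul_pow_le (hψ0 T) hd hlam0 hrate (hA T) (hAhat T) (k + 1) 0
    simp only [pow_zero, one_mul, mul_one] at h
    exact h.trans (mul_le_mul_of_nonneg_left (hpow k) (hψ0 T))
  · have hc : (ξ T * ψ T ^ 3) ^ m = ξ T ^ m * ψ T ^ (3 * m) := by
      rw [Real.mul_rpow (hξ T) (pow_nonneg (hψ0 T) 3), Real.rpow_mul (hψ0 T)]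
      norm_cast
    rw [mul_assoc _ (ξ T ^ m), ← hc]
    refine summable_and_tsum_rpow_mul_rpow_le hm (mul_nonneg (hξ T) (pow_nonneg (hψ0 T) 3))
      (fun _ => norm_nonneg _) hg0 (fun k => ?_) hs
    have h := norm_pow_mul_pow_sub_pow_le (hψ0 T) hd hlam0 hrate (hA T) (hAhat T) k 0
    simp only [pow_zero, one_mul, mul_one] at h
    refine h.trans_eq ?_
    rw [Nat.add_sub_cancel]
    push_cast
    ring
end
end

section
/- Let 𝔸 be a square matrix satisfying ‖𝔸^j‖_∞ ≤ ψ_N λ^j for all j ≥ 0, where λ ≤ C < 1 and 1 ≤ ψ_N < ∞, and let Â satisfy ‖Â − 𝔸‖_∞ ≤ ξ_{N,T} ψ_N. If ξ_{N,T} ψ_N² → 0 and log(ξ_{N,T})/log(ψ_N) → −∞, then for N, T sufficiently large the spectral radius of Â satisfies ρ(Â) ≤ λ′ for some constant λ < λ′ < 1; in particular one may take λ′ = (2 + λ)/3. -/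
open Filter

noncomputable section

section MatInf

attribute [local instance] Matrix.linftyOpNormedAddCommGroup

theorem matInf_eq_linfty_opNorm {α β : Type*} [Fintype α] [Fintype β] (A : Matrix α β ℝ) :
    matInf A = ‖A‖ := by
  rw [Matrix.linfty_opNorm_def, Finset.sup_univ_eq_ciSup, NNReal.coe_iSup]
  simp [matInf]

theorem matInf_nonneg {α β : Type*} [Fintype β] (A : Matrix α β ℝ) : 0 ≤ matInf A :=
  Real.iSup_nonneg fun _ => Finset.sum_nonneg fun _ _ => abs_nonneg _

theorem matInf_add_le {α β : Type*} [Fintype α] [Fintype β] (A B : Matrix α β ℝ) :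
    matInf (A + B) ≤ matInf A + matInf B := by
  simpa only [matInf_eq_linfty_opNorm] using norm_add_le A B

theorem matInf_mul_le {α β γ : Type*} [Fintype α] [Fintype β] [Fintype γ]
    (A : Matrix α β ℝ) (B : Matrix β γ ℝ) : matInf (A * B) ≤ matInf A * matInf B := by
  simpa only [matInf_eq_linfty_opNorm] using Matrix.linfty_opNorm_mul A B

end MatInf

/-- If the powers of `A` decay like `c * r ^ j`, then those of a perturbation `B` with
`‖B - A‖_∞ ≤ e` grow at most like `c * (r + c * e) ^ k`. -/
theorem matInf_pow_mul_pow_le {α : Type*} [Fintype α] [DecidableEq α] {A B : Matrix α α ℝ}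
    {c r e : ℝ} (hc : 0 ≤ c) (hr : 0 ≤ r) (hA : ∀ j : ℕ, matInf (A ^ j) ≤ c * r ^ j)
    (hB : matInf (B - A) ≤ e) (k j : ℕ) :
    matInf (A ^ j * B ^ k) ≤ c * r ^ j * (r + c * e) ^ k := by
  induction k generalizing j with
  | zero => simpa using hA j
  | succ k ih =>
    have he : 0 ≤ e := (matInf_nonneg _).trans hB
    have hk : matInf (B ^ k) ≤ c * (r + c * e) ^ k := by simpa using ih 0
    calc matInf (A ^ j * B ^ (k + 1))
        = matInf (A ^ (j + 1) * B ^ k + A ^ j * ((B - A) * B ^ k)) := by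
          congr 1
          rw [pow_succ' B, pow_succ A]
          noncomm_ring
      _ ≤ matInf (A ^ (j + 1) * B ^ k) + matInf (A ^ j) * (matInf (B - A) * matInf (B ^ k)) :=
          (matInf_add_le _ _).trans <| add_le_add le_rfl <| (matInf_mul_le _ _).trans <|
            mul_le_mul_of_nonneg_left (matInf_mul_le _ _) (matInf_nonneg _)
      _ ≤ c * r ^ (j + 1) * (r + c * e) ^ k + c * r ^ j * (e * (c * (r + c * e) ^ k)) := by
          have h0 := matInf_nonneg (B - A)
          have h1 := matInf_nonneg (B ^ k)
          have h2 := hA j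
          have h3 := ih (j + 1)
          gcongr
      _ = c * r ^ j * (r + c * e) ^ (k + 1) := by ring

/-- The root test: a sequence dominated by `c * r ^ k` has `k`-th roots with limsup at most `r`. -/
theorem limsup_rpow_one_div_le {u : ℕ → ℝ} {c r : ℝ} (hu : ∀ k, 0 ≤ u k) (hc : 0 < c)
    (hr : 0 ≤ r) (h : ∀ k, u k ≤ c * r ^ k) :
    limsup (fun k : ℕ => u k ^ ((1 : ℝ) / (k : ℝ))) atTop ≤ r := by
  have hlim : Tendsto (fun k : ℕ => c ^ ((1 : ℝ) / (k : ℝ)) * r) atTop (nhds r) := by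
    have h1 : Tendsto (fun k : ℕ => c ^ ((1 : ℝ) / (k : ℝ))) atTop (nhds (c ^ (0 : ℝ))) :=
      tendsto_const_nhds.rpow tendsto_one_div_atTop_nhds_zero_nat (Or.inl hc.ne')
    simpa using h1.mul_const r
  rw [← hlim.limsup_eq]
  refine limsup_le_limsup ?_ ?_ hlim.isBoundedUnder_le
  · filter_upwards [eventually_ne_atTop 0] with k hk
    calc u k ^ ((1 : ℝ) / (k : ℝ)) ≤ (c * r ^ k) ^ ((1 : ℝ) / (k : ℝ)) :=
          Real.rpow_le_rpow (hu k) (h k) (by positivity)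
      _ = c ^ ((1 : ℝ) / (k : ℝ)) * r := by
          rw [Real.mul_rpow hc.le (pow_nonneg hr k), one_div, Real.pow_rpow_inv_natCast hr hk]
  · exact IsCoboundedUnder.of_frequently_ge (a := 0)
      (Eventually.of_forall fun k => Real.rpow_nonneg (hu k) _).frequently

/-- **Lemma A.7** (stationarity of the estimated VAR): if `‖𝔸^j‖_∞ ≤ ψ_N λ^j`
with `λ ≤ C < 1`, `‖Â − 𝔸‖_∞ ≤ ξ_{N,T} ψ_N`, `ξ_{N,T} ψ_N² → 0` and
`log(ξ_{N,T})/log(ψ_N) → −∞`, then for `N, T` sufficiently large the spectral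
radius `ρ(Â) = lim_k ‖Â^k‖_∞^{1/k}` is at most `λ' = (2 + λ)/3 < 1`. -/
theorem estimated_VAR_stationary (lamC : ℝ) (hlamC : lamC < 1)
    (n : ℕ → ℕ) (ψ ξ : ℕ → ℝ) (lam : ℝ)
    (hlam0 : 0 ≤ lam) (hlam1 : lam ≤ lamC)
    (hψ : ∀ T, 1 ≤ ψ T) (hξ : ∀ T, 0 < ξ T)
    (A Ahat : (T : ℕ) → Matrix (Fin (n T)) (Fin (n T)) ℝ)
    (hA : ∀ T (j : ℕ), matInf (A T ^ j) ≤ ψ T * lam ^ j)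
    (hAhat : ∀ T, matInf (Ahat T - A T) ≤ ξ T * ψ T)
    (hrate1 : Tendsto (fun T => ξ T * ψ T ^ 2) atTop (nhds 0))
    (hrate2 : Tendsto (fun T => Real.log (ξ T) / Real.log (ψ T)) atTop atBot) :
    ∀ᶠ T in atTop,
      Filter.limsup (fun k : ℕ => matInf (Ahat T ^ k) ^ ((1 : ℝ) / (k : ℝ))) atTop
        ≤ (2 + lam) / 3 := by
  have hgap : 0 < (2 + lam) / 3 - lam := by linarith
  filter_upwards [hrate1.eventually_lt_const hgap] with T hT
  have hψ0 : 0 < ψ T := zero_lt_one.trans_le (hψ T)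
  have hξ0 := hξ T
  have hpow (k : ℕ) : matInf (Ahat T ^ k) ≤ ψ T * (lam + ψ T * (ξ T * ψ T)) ^ k := by
    simpa using matInf_pow_mul_pow_le hψ0.le hlam0 (hA T) (hAhat T) k 0
  refine (limsup_rpow_one_div_le (fun k => matInf_nonneg _) hψ0 (by positivity) hpow).trans ?_
  linarith [show ψ T * (ξ T * ψ T) = ξ T * ψ T ^ 2 by ring]
end
end

section
/- Let ε_t and ε̂_t, t = 1, …, T, be N-dimensional vectors such that max_{1≤j≤N} T^{−1} ‖ε̂_j − ε_j‖₂² ≤ φ_{N,T} (where ε_j = (ε_{j,1},…,ε_{j,T})′ and similarly for ε̂_j) and max_{1≤j≤N} |T^{−1} Σ_{t=1}^T ε_{j,t}²| ≤ C d_N² with d_N ≥ 1. Then ‖ T^{−1} Σ_{t=1}^T ε̂_t ε̂_t′ − T^{−1} Σ_{t=1}^T ε_t ε_t′ ‖_max ≤ C ( φ_{N,T} + d_N² √φ_{N,T} ). -/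
noncomputable section

/-- Max-entry norm of a matrix. -/
def matMax {α β : Type*} (A : Matrix α β ℝ) : ℝ :=
  ⨆ i, ⨆ j, |A i j|

/-- Cauchy-Schwarz inequality for weighted sums with a constant nonnegative weight. -/
theorem abs_mul_sum_mul_le {ι : Type*} [Fintype ι] {c a b : ℝ} (hc : 0 ≤ c) (ha : 0 ≤ a)
    (hb : 0 ≤ b) (f g : ι → ℝ) (hf : c * ∑ t, f t ^ 2 ≤ a ^ 2) (hg : c * ∑ t, g t ^ 2 ≤ b ^ 2) :
    |c * ∑ t, f t * g t| ≤ a * b := by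
  refine abs_le_of_sq_le_sq ?_ (mul_nonneg ha hb)
  calc (c * ∑ t, f t * g t) ^ 2 = c ^ 2 * (∑ t, f t * g t) ^ 2 := mul_pow _ _ _
    _ ≤ c ^ 2 * ((∑ t, f t ^ 2) * ∑ t, g t ^ 2) := by
        gcongr
        exact Finset.sum_mul_sq_le_sq_mul_sq _ _ _
    _ = (c * ∑ t, f t ^ 2) * (c * ∑ t, g t ^ 2) := by ring
    _ ≤ a ^ 2 * b ^ 2 := by
        gcongr
    _ = (a * b) ^ 2 := (mul_pow _ _ _).symm

/-- A nonnegative bound on all entries bounds the max-entry norm. -/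
theorem matMax_le {α β : Type*} {A : Matrix α β ℝ} {b : ℝ} (hb : 0 ≤ b)
    (h : ∀ i j, |A i j| ≤ b) : matMax A ≤ b :=
  Real.iSup_le (fun i => Real.iSup_le (h i) hb) hb

/-- **Lemma A.10**: deterministic bound on the max-entry distance between the
empirical covariance matrices of residuals and true errors, given the
residual-consistency bound (event `Q`) and the bound on average squared errors
(event `R`). -/
theorem empirical_covariance_residual_bound (C1 : ℝ) (hC1 : 0 < C1) :
    ∃ C : ℝ, 0 < C ∧
      ∀ (N T : ℕ), 1 ≤ T →
      ∀ (ε εhat : Fin T → Fin N → ℝ) (φ dN : ℝ),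
        0 ≤ φ → 1 ≤ dN →
        -- event Q: residual consistency
        (∀ j, (T : ℝ)⁻¹ * ∑ t, (εhat t j - ε t j) ^ 2 ≤ φ) →
        -- event R: bounded average squared errors
        (∀ j, |(T : ℝ)⁻¹ * ∑ t, (ε t j) ^ 2| ≤ C1 * dN ^ 2) →
        matMax (Matrix.of (fun i j => (T : ℝ)⁻¹ * ∑ t, εhat t i * εhat t j)
            - Matrix.of (fun i j => (T : ℝ)⁻¹ * ∑ t, ε t i * ε t j))
          ≤ C * (φ + dN ^ 2 * Real.sqrt φ) := by
  refine ⟨1 + 2 * √C1, by positivity, ?_⟩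
  intro N T _ ε εhat φ dN hφ hdN hQ hR
  have hd : 0 ≤ dN := by linarith
  have hc : (0 : ℝ) ≤ (T : ℝ)⁻¹ := by positivity
  refine matMax_le (by positivity) fun i j => ?_
  have hQ' (k) : (T : ℝ)⁻¹ * ∑ t, (εhat t k - ε t k) ^ 2 ≤ √φ ^ 2 := by
    rw [Real.sq_sqrt hφ]; exact hQ k
  have hR' (k) : (T : ℝ)⁻¹ * ∑ t, (ε t k) ^ 2 ≤ (√C1 * dN) ^ 2 := by
    rw [mul_pow, Real.sq_sqrt hC1.le]; exact (le_abs_self _).trans (hR k)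
  have hdC : 0 ≤ √C1 * dN := by positivity
  have huv := abs_mul_sum_mul_le hc (Real.sqrt_nonneg φ) (Real.sqrt_nonneg φ) _ _ (hQ' i) (hQ' j)
  have hue := abs_mul_sum_mul_le hc (Real.sqrt_nonneg φ) hdC _ _ (hQ' i) (hR' j)
  have hev := abs_mul_sum_mul_le hc hdC (Real.sqrt_nonneg φ) _ _ (hR' i) (hQ' j)
  rw [Real.mul_self_sqrt hφ] at huv
  have hdecomp : (T : ℝ)⁻¹ * ∑ t, εhat t i * εhat t j - (T : ℝ)⁻¹ * ∑ t, ε t i * ε t j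
      = (T : ℝ)⁻¹ * ∑ t, (εhat t i - ε t i) * (εhat t j - ε t j)
        + (T : ℝ)⁻¹ * ∑ t, (εhat t i - ε t i) * ε t j
        + (T : ℝ)⁻¹ * ∑ t, ε t i * (εhat t j - ε t j) := by
    rw [← mul_sub, ← mul_add, ← mul_add, ← Finset.sum_sub_distrib, ← Finset.sum_add_distrib,
      ← Finset.sum_add_distrib]
    congr 1
    exact Finset.sum_congr rfl fun t _ => by ring
  rw [Matrix.sub_apply, Matrix.of_apply, Matrix.of_apply, hdecomp]
  have hdd : dN ≤ dN ^ 2 := by nlinarith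
  calc _ ≤ φ + √φ * (√C1 * dN) + √C1 * dN * √φ :=
        (abs_add_three _ _ _).trans (add_le_add (add_le_add huv hue) hev)
    _ = φ + 2 * √C1 * (dN * √φ) := by ring
    _ ≤ φ + 2 * √C1 * (dN ^ 2 * √φ) := by gcongr
    _ ≤ (1 + 2 * √C1) * (φ + dN ^ 2 * √φ) := by
        have h₁ : 0 ≤ √C1 * φ := by positivity
        have h₂ : 0 ≤ dN ^ 2 * √φ := by positivity
        linarith
end
end
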